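/- arXiv:2308.06239 — 2 statements merged into one kernel-verified Lean document; each statement's English description precedes it below -/
import Mathlib

section
/- Let Q be a class of probability distributions over a measurable space X. Suppose Q is public-privately learnable with m_P(α,β,ε) public and n(α,β,ε) private samples. Then for every ε > 0, Q is list learnable to list size ℓ(α,β) = (10/9)·exp( ε · n(α/2, β/10, ε) ) with m(α,β) = m_P(α/2, β/10, ε) samples. -/
open MeasureTheory ENNReal

namespace PubPriv

variable {X : Type*} [MeasurableSpace X]

/-- The canonical measurable structure on the space of probability measures,
inherited from the Giry measurable structure on measures. -/
instance : MeasurableSpace (ProbabilityMeasure X) := Subtype.instMeasurableSpace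

/-- Total variation distance between two measures. -/
noncomputable def tv (p q : Measure X) : ℝ :=
  ⨆ B : {s : Set X // MeasurableSet s}, |(p B).toReal - (q B).toReal|

/-- The law of `m` i.i.d. samples from `p`. -/
noncomputable def iid (p : Measure X) (m : ℕ) : Measure (Fin m → X) :=
  Measure.pi fun _ => p

/-- Two datasets differing in (at most) one entry. -/
def Adjacent {n : ℕ} (x x' : Fin n → X) : Prop :=
  ∃ i : Fin n, ∀ j : Fin n, j ≠ i → x j = x' j

/-- Pure `ε`-differential privacy. -/
def IsDP {Y : Type*} [MeasurableSpace Y] {n : ℕ}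
    (A : (Fin n → X) → Measure Y) (ε : ℝ) : Prop :=
  ∀ x x' : Fin n → X, Adjacent x x' →
    ∀ B : Set Y, MeasurableSet B → A x B ≤ ENNReal.ofReal (Real.exp ε) * A x' B

/-- An `(α,β,ε)`-public-private learner for `Q` with `m` public and `n` private samples. -/
structure IsPPLearner (Q : Set (ProbabilityMeasure X)) (α β ε : ℝ) {m n : ℕ}
    (A : (Fin m → X) → (Fin n → X) → Measure (ProbabilityMeasure X)) : Prop where
  measurable : Measurable fun z : (Fin m → X) × (Fin n → X) => A z.1 z.2
  isProb : ∀ xt x, IsProbabilityMeasure (A xt x)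
  dp : ∀ xt, IsDP (A xt) ε
  accurate : ∀ p ∈ Q,
    ENNReal.ofReal (1 - β) ≤
      ∫⁻ xt, (∫⁻ x, A xt x {q : ProbabilityMeasure X | tv q.toMeasure p.toMeasure ≤ α}
        ∂(iid p.toMeasure n)) ∂(iid p.toMeasure m)

/-- `Q` is public-privately learnable with sample complexities `m`, `n`. -/
def PPLearnable (Q : Set (ProbabilityMeasure X)) (m n : ℝ → ℝ → ℝ → ℕ) : Prop :=
  ∀ α β ε : ℝ, α ∈ Set.Ioc (0:ℝ) 1 → β ∈ Set.Ioc (0:ℝ) 1 → 0 < ε →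
    ∃ A : (Fin (m α β ε) → X) → (Fin (n α β ε) → X) → Measure (ProbabilityMeasure X),
      IsPPLearner Q α β ε A

/-- An `(α,β,ℓ)`-list learner for `Q` with `m` samples. -/
structure IsListLearner (Q : Set (ProbabilityMeasure X)) (α β : ℝ) (ℓ : ℝ) {m : ℕ}
    (L : (Fin m → X) → Finset (ProbabilityMeasure X)) : Prop where
  card_le : ∀ x, ((L x).card : ℝ) ≤ ℓ
  accurate : ∀ p ∈ Q,
    ENNReal.ofReal (1 - β) ≤
      iid p.toMeasure m {x | ∃ q ∈ L x, tv p.toMeasure q.toMeasure ≤ α}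

/-- `Q` is list learnable to list size `ℓ` with `m` samples. -/
def ListLearnable (Q : Set (ProbabilityMeasure X)) (ℓ : ℝ → ℝ → ℝ) (m : ℝ → ℝ → ℕ) : Prop :=
  ∀ α β : ℝ, α ∈ Set.Ioc (0:ℝ) 1 → β ∈ Set.Ioc (0:ℝ) 1 →
    ∃ L : (Fin (m α β) → X) → Finset (ProbabilityMeasure X),
      IsListLearner Q α β (ℓ α β) L

/-- `Q` admits `(τ, t, m)` `r`-robust sample compression. -/
def RobustCompression (Q : Set (ProbabilityMeasure X)) (r : ℝ)
    (τ t m : ℝ → ℝ → ℕ) : Prop :=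
  ∀ α β : ℝ, α ∈ Set.Ioc (0:ℝ) 1 → β ∈ Set.Ioc (0:ℝ) 1 →
    ∃ g : (Fin (τ α β) → X) × (Fin (t α β) → Bool) → ProbabilityMeasure X,
      ∀ q ∈ Q, ∃ f : (Fin (m α β) → X) → (Fin (τ α β) → X) × (Fin (t α β) → Bool),
        (∀ x i, ∃ j, (f x).1 i = x j) ∧
        ∀ p : ProbabilityMeasure X, tv p.toMeasure q.toMeasure ≤ r →
          ENNReal.ofReal (1 - β) ≤
            iid p.toMeasure (m α β) {x | tv (g (f x)).toMeasure q.toMeasure ≤ α}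


lemma tv_comm' (p q : Measure X) : tv p q = tv q p := by
  unfold tv
  congr 1
  funext B
  exact abs_sub_comm _ _

lemma abs_le_tv (p q : ProbabilityMeasure X) {B : Set X} (hB : MeasurableSet B) :
    |((p : Measure X) B).toReal - ((q : Measure X) B).toReal| ≤ tv p.toMeasure q.toMeasure := by
  unfold tv
  refine le_ciSup (f := fun B : {s : Set X // MeasurableSet s} =>
    |((p : Measure X) B).toReal - ((q : Measure X) B).toReal|) ?_ ⟨B, hB⟩
  refine ⟨1, ?_⟩
  rintro _ ⟨S, rfl⟩
  have h1 : ((p : Measure X) S).toReal ≤ 1 :=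
    ENNReal.toReal_le_of_le_ofReal zero_le_one (by simpa using prob_le_one)
  have h2 : ((q : Measure X) S).toReal ≤ 1 :=
    ENNReal.toReal_le_of_le_ofReal zero_le_one (by simpa using prob_le_one)
  have h3 : 0 ≤ ((p : Measure X) S).toReal := ENNReal.toReal_nonneg
  have h4 : 0 ≤ ((q : Measure X) S).toReal := ENNReal.toReal_nonneg
  show |_| ≤ _
  rw [abs_le]
  constructor <;> linarith

lemma exists_sep (p q : Measure X) {α : ℝ} (h : α < tv p q) :
    ∃ B : Set X, MeasurableSet B ∧ α < |(p B).toReal - (q B).toReal| := by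
  unfold tv at h
  haveI : Nonempty {s : Set X // MeasurableSet s} := ⟨⟨∅, MeasurableSet.empty⟩⟩
  obtain ⟨B, hB⟩ := exists_lt_of_lt_ciSup h
  exact ⟨B, B.2, hB⟩

lemma measurable_slab (p : ProbabilityMeasure X) {B : Set X} (hB : MeasurableSet B) (α : ℝ) :
    MeasurableSet {q : ProbabilityMeasure X |
      |((q : Measure X) B).toReal - ((p : Measure X) B).toReal| ≤ α} := by
  have h1 : Measurable fun q : ProbabilityMeasure X => (q : Measure X) B :=
    (Measure.measurable_coe hB).comp measurable_subtype_coe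
  have h2 : Measurable fun q : ProbabilityMeasure X =>
      |((q : Measure X) B).toReal - ((p : Measure X) B).toReal| := by
    have h3 := h1.ennreal_toReal.sub_const ((p : Measure X) B).toReal
    exact continuous_abs.measurable.comp h3
  exact h2 measurableSet_Iic

lemma packing_card (μ : Measure (ProbabilityMeasure X)) [IsProbabilityMeasure μ]
    {α : ℝ} (E c : ℝ≥0∞) (F : Finset (ProbabilityMeasure X))
    (hheavy : ∀ p ∈ F, c ≤ E * μ {q | tv q.toMeasure p.toMeasure ≤ α / 2})
    (hsep : ∀ p ∈ F, ∀ q ∈ F, p ≠ q → α < tv p.toMeasure q.toMeasure) :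
    (F.card : ℝ≥0∞) * c ≤ E := by
  classical
  have hex : ∀ p q : ProbabilityMeasure X, ∃ B : Set X, MeasurableSet B ∧
      (α < tv p.toMeasure q.toMeasure →
        α < |((p : Measure X) B).toReal - ((q : Measure X) B).toReal|) := by
    intro p q
    by_cases h : α < tv p.toMeasure q.toMeasure
    · obtain ⟨B, hB, h'⟩ := exists_sep _ _ h
      exact ⟨B, hB, fun _ => h'⟩
    · exact ⟨∅, MeasurableSet.empty, fun h' => absurd h' h⟩
  choose S hSm hS using hex
  let T : ProbabilityMeasure X → Set (ProbabilityMeasure X) := fun p =>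
    ⋂ r ∈ F, ({q | |((q : Measure X) (S p r)).toReal - ((p : Measure X) (S p r)).toReal| ≤ α / 2}
      ∩ {q | |((q : Measure X) (S r p)).toReal - ((p : Measure X) (S r p)).toReal| ≤ α / 2})
  have hTm : ∀ p, MeasurableSet (T p) := fun p =>
    Finset.measurableSet_biInter _ fun r _ =>
      (measurable_slab p (hSm p r) _).inter (measurable_slab p (hSm r p) _)
  have hsub : ∀ p, {q : ProbabilityMeasure X | tv q.toMeasure p.toMeasure ≤ α / 2} ⊆ T p := by
    intro p q hq
    simp only [T, Set.mem_iInter]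
    intro r _
    exact ⟨(abs_le_tv q p (hSm p r)).trans hq, (abs_le_tv q p (hSm r p)).trans hq⟩
  have hdisj : (F : Set (ProbabilityMeasure X)).PairwiseDisjoint T := by
    intro p hp r hr hpr
    refine Set.disjoint_left.2 fun q hqp hqr => ?_
    simp only [T, Set.mem_iInter] at hqp hqr
    have h1 := (hqp r hr).1
    have h2 := (hqr p hp).2
    have h3 := hS p r (hsep p hp r hr hpr)
    simp only [Set.mem_setOf_eq] at h1 h2
    rw [abs_le] at h1 h2
    rw [lt_abs] at h3
    rcases h3 with h3 | h3 <;> linarith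
  calc (F.card : ℝ≥0∞) * c = ∑ p ∈ F, c := by simp
    _ ≤ ∑ p ∈ F, E * μ (T p) := Finset.sum_le_sum fun p hp =>
        (hheavy p hp).trans (by gcongr; exact hsub p)
    _ = E * μ (⋃ p ∈ F, T p) := by
        rw [← Finset.mul_sum, measure_biUnion_finset hdisj fun p _ => hTm p]
    _ ≤ E * 1 := by gcongr; exact prob_le_one
    _ = E := mul_one E

lemma group_privacy {Y : Type*} [MeasurableSpace Y] {n : ℕ}
    (A : (Fin n → X) → Measure Y) {ε : ℝ} (hA : IsDP A ε) (x x' : Fin n → X) (B : Set Y) :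
    A x B ≤ ENNReal.ofReal (Real.exp ε) ^ n * A x' B := by
  have hdp : ∀ x x' : Fin n → X, Adjacent x x' →
      A x B ≤ ENNReal.ofReal (Real.exp ε) * A x' B := by
    intro x x' hx
    calc A x B ≤ A x (toMeasurable (A x') B) := measure_mono (subset_toMeasurable _ _)
      _ ≤ _ := hA x x' hx _ (measurableSet_toMeasurable _ _)
      _ = _ := by rw [measure_toMeasurable]
  have key : ∀ k ≤ n, A x B ≤ ENNReal.ofReal (Real.exp ε) ^ k *
      A (fun j => if (j : ℕ) < k then x' j else x j) B := by
    intro k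
    induction k with
    | zero => intro _; simp
    | succ k ih =>
      intro hk
      refine (ih (by omega)).trans ?_
      rw [pow_succ, mul_assoc]
      gcongr
      apply hdp
      refine ⟨⟨k, by omega⟩, fun j hj => ?_⟩
      have : (j : ℕ) ≠ k := fun h => hj (Fin.ext h)
      have : (j : ℕ) < k ↔ (j : ℕ) < k + 1 := by omega
      simp [this]
  have := key n le_rfl
  simpa using this

lemma exists_packing (μ : Measure (ProbabilityMeasure X)) [IsProbabilityMeasure μ]
    {α : ℝ} (hα : 0 ≤ α) (E : ℝ) (hE : 0 ≤ E) :
    ∃ F : Finset (ProbabilityMeasure X), (F.card : ℝ) ≤ (10 / 9) * E ∧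
      ∀ p : ProbabilityMeasure X,
        ENNReal.ofReal (9 / 10) ≤
          ENNReal.ofReal E * μ {q | tv q.toMeasure p.toMeasure ≤ α / 2} →
        ∃ q ∈ F, tv p.toMeasure q.toMeasure ≤ α := by
  classical
  let good : Finset (ProbabilityMeasure X) → Prop := fun F =>
    (∀ p ∈ F, ENNReal.ofReal (9 / 10) ≤
      ENNReal.ofReal E * μ {q | tv q.toMeasure p.toMeasure ≤ α / 2}) ∧
    (∀ p ∈ F, ∀ q ∈ F, p ≠ q → α < tv p.toMeasure q.toMeasure)
  have hcard : ∀ F, good F → (F.card : ℝ) ≤ (10 / 9) * E := by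
    intro F hF
    have h := packing_card μ _ _ F hF.1 hF.2
    rw [← ENNReal.ofReal_natCast, ← ENNReal.ofReal_mul (by positivity),
      ENNReal.ofReal_le_ofReal_iff hE] at h
    linarith
  let K : Set ℕ := {k | ∃ F, good F ∧ F.card = k}
  have hne : K.Nonempty := ⟨0, ∅, by simp [good], rfl⟩
  have hbdd : BddAbove K := by
    refine ⟨⌈(10 / 9) * E⌉₊, ?_⟩
    rintro _ ⟨F, hF, rfl⟩
    exact_mod_cast (hcard F hF).trans (Nat.le_ceil _)
  obtain ⟨F, hF, hFc⟩ := Nat.sSup_mem hne hbdd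
  refine ⟨F, hcard F hF, fun p hp => ?_⟩
  by_contra! hcon
  have hself : tv p.toMeasure p.toMeasure = 0 := by simp [tv]
  have hpF : p ∉ F := fun hmem => by
    have := hcon p hmem
    linarith
  have hgood : good (insert p F) := by
    refine ⟨?_, ?_⟩
    · intro r hr
      rcases Finset.mem_insert.1 hr with rfl | hr
      · exact hp
      · exact hF.1 r hr
    · intro r hr s hs hrs
      rcases Finset.mem_insert.1 hr with h1 | h1 <;> rcases Finset.mem_insert.1 hs with h2 | h2
      · exact absurd (h1.trans h2.symm) hrs
      · rw [h1]; exact hcon s h2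
      · rw [h2, tv_comm']; exact hcon r h1
      · exact hF.2 r h1 s h2 hrs
  have := le_csSup hbdd (show (insert p F).card ∈ K from ⟨_, hgood, rfl⟩)
  rw [Finset.card_insert_of_notMem hpF, ← hFc] at this
  omega

lemma markov_aux {Ω : Type*} [MeasurableSpace Ω] (ν : Measure Ω) [IsProbabilityMeasure ν]
    (f : Ω → ℝ≥0∞) (hf : ∀ x, f x ≤ 1) {β : ℝ} (hβ : β ≤ 1)
    (h : ENNReal.ofReal (1 - β / 10) ≤ ∫⁻ x, f x ∂ν) :
    ENNReal.ofReal (1 - β) ≤ ν {x | ENNReal.ofReal (9 / 10) ≤ f x} := by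
  set S := {x | ENNReal.ofReal (9 / 10) ≤ f x} with hS
  set T := toMeasurable ν S with hT
  have hTm : MeasurableSet T := measurableSet_toMeasurable _ _
  have h1 : ∫⁻ x, f x ∂ν ≤ ∫⁻ x, (ENNReal.ofReal (9 / 10)
      + T.indicator (fun _ => ENNReal.ofReal (1 / 10)) x) ∂ν := by
    refine lintegral_mono fun x => ?_
    by_cases hx : x ∈ T
    · simp only [Set.indicator_of_mem hx]
      rw [← ENNReal.ofReal_add (by norm_num) (by norm_num)]
      norm_num
      exact hf x
    · simp only [Set.indicator_of_notMem hx, add_zero]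
      have : x ∉ S := fun hxS => hx (subset_toMeasurable _ _ hxS)
      exact (not_le.1 this).le
  rw [lintegral_add_left measurable_const, lintegral_const, measure_univ, mul_one,
    lintegral_indicator_const hTm, hT, measure_toMeasurable] at h1
  have h2 := h.trans h1
  have hfin : ν S ≠ ∞ := measure_ne_top _ _
  rw [← ENNReal.ofReal_toReal hfin, ← ENNReal.ofReal_mul (by norm_num),
    ← ENNReal.ofReal_add (by norm_num) (by positivity),
    ENNReal.ofReal_le_ofReal_iff (by positivity)] at h2
  rw [← ENNReal.ofReal_toReal hfin]
  apply ENNReal.ofReal_le_ofReal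
  linarith

/-- **Public-private learning implies list learning** (Proposition 3.3): if `Q` is
public-privately learnable with `m_P(α,β,ε)` public and `n(α,β,ε)` private samples, then
for every `ε > 0`, `Q` is list learnable to list size
`ℓ(α,β) = (10/9)·exp(ε·n(α/2, β/10, ε))` with `m(α,β) = m_P(α/2, β/10, ε)` samples. -/
theorem ppLearning_implies_listLearning
    {X : Type*} [MeasurableSpace X] (Q : Set (ProbabilityMeasure X))
    (mP n : ℝ → ℝ → ℝ → ℕ)
    (h : PPLearnable Q mP n) :
    ∀ ε : ℝ, 0 < ε →
      ListLearnable Q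
        (fun α β => (10/9) * Real.exp (ε * (n (α/2) (β/10) ε : ℝ)))
        (fun α β => mP (α/2) (β/10) ε) := by
  intro ε hε α β hα hβ
  obtain ⟨A, hA⟩ := h (α / 2) (β / 10) ε ⟨by linarith [hα.1], by linarith [hα.2]⟩
    ⟨by linarith [hβ.1], by linarith [hβ.2]⟩ hε
  by_cases hX : Nonempty X
  swap
  · refine ⟨fun _ => ∅, fun _ => by simp; positivity, fun p _ => ?_⟩
    exact absurd (nonempty_of_isProbabilityMeasure p.toMeasure) hX
  obtain ⟨z⟩ := hX
  have hpk := fun xt => by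
    haveI := hA.isProb xt (fun _ => z)
    exact exists_packing (A xt fun _ => z) hα.1.le
      (Real.exp (ε * (n (α/2) (β/10) ε : ℝ))) (Real.exp_pos _).le
  choose L hL1 hL2 using hpk
  refine ⟨L, hL1, fun p hp => ?_⟩
  have hacc := hA.accurate p hp
  haveI : ∀ k, IsProbabilityMeasure (iid p.toMeasure k) := fun k => by
    unfold iid; infer_instance
  have hm := markov_aux _ _ (fun xt => ?_) hβ.2 hacc
  · refine hm.trans (measure_mono fun xt hxt => hL2 xt p (le_trans hxt ?_))
    calc _ ≤ ∫⁻ x, ENNReal.ofReal (Real.exp ε) ^ (n (α/2) (β/10) ε) *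
            A xt (fun _ => z) {q | tv q.toMeasure p.toMeasure ≤ α / 2} ∂(iid p.toMeasure _) :=
          lintegral_mono fun x => group_privacy _ (hA.dp xt) _ _ _
      _ = _ := by
          rw [lintegral_const, measure_univ, mul_one, ← ENNReal.ofReal_pow (Real.exp_pos _).le,
            ← Real.exp_nat_mul, mul_comm ε]
  · calc _ ≤ ∫⁻ x, 1 ∂(iid p.toMeasure _) := lintegral_mono fun x => by
            haveI := hA.isProb xt x
            exact prob_le_one
      _ = 1 := by simp

end PubPriv
end

section
/- Let d ≥ 1 and let Q be the class of all Gaussian distributions on ℝ^d. There exist α_d, β_d > 0 such that for every n ∈ ℕ, there is no (α_d, β_d, 1)-public-private learner for Q using d − 1 public samples and n private samples. In particular, Q is not public-privately learnable with m(α,β,ε) = d − 1 public samples, regardless of the number of private samples. -/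
open MeasureTheory ENNReal

namespace PubPriv

variable {X : Type*} [MeasurableSpace X]

open Matrix in
/-- The class of all Gaussian distributions on `ℝ^d`: a probability measure is Gaussian
with mean `μ` and positive semidefinite covariance `S` iff each of its one-dimensional
linear projections is the corresponding univariate Gaussian. -/
noncomputable def GaussianClass (d : ℕ) : Set (ProbabilityMeasure (Fin d → ℝ)) :=
  {p | ∃ (μ : Fin d → ℝ) (S : Matrix (Fin d) (Fin d) ℝ), S.PosSemidef ∧
      ∀ u : Fin d → ℝ,
        p.toMeasure.map (fun x => ∑ i, u i * x i) =
          ProbabilityTheory.gaussianReal (∑ i, u i * μ i)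
            (Real.toNNReal (u ⬝ᵥ S.mulVec u)) }


section Aux

open ProbabilityTheory Matrix

noncomputable abbrev gam (k : ℕ) : Measure (Fin k → ℝ) := Measure.pi fun _ => gaussianReal 0 1

lemma gam_lin (k : ℕ) (w : Fin k → ℝ) :
    (gam k).map (fun z => ∑ i, w i * z i) = gaussianReal 0 (Real.toNNReal (∑ i, w i ^ 2)) := by
  have hm : Measurable (fun z : Fin k → ℝ => ∑ i, w i * z i) := by fun_prop
  have : IsProbabilityMeasure ((gam k).map (fun z => ∑ i, w i * z i)) :=
    Measure.isProbabilityMeasure_map hm.aemeasurable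
  apply Measure.ext_of_charFun
  ext t
  have h := charFun_stdGaussian (E := EuclideanSpace ℝ (Fin k)) (WithLp.toLp 2 (t • w))
  rw [← map_pi_eq_stdGaussian, charFun_apply, integral_map (by fun_prop) (by fun_prop)] at h
  rw [charFun_gaussianReal, charFun_apply, integral_map hm.aemeasurable (by fun_prop)]
  convert h using 1
  · congr 1
    ext z
    congr 3
    simp [PiLp.inner_apply, Finset.mul_sum]
    refine Finset.sum_congr rfl fun i _ => by ring
  · congr 1
    have hn : 0 ≤ ∑ i, w i ^ 2 := Finset.sum_nonneg fun i _ => sq_nonneg _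
    rw [← Complex.ofReal_pow ‖_‖, EuclideanSpace.norm_sq_eq]
    simp [mul_pow, Real.coe_toNNReal _ hn, ← Finset.mul_sum]
    ring

noncomputable def gr {k : ℕ} (b : ℝ) (a : Fin k → ℝ) (z : Fin k → ℝ) : Fin (k+1) → ℝ :=
  Fin.cons (b + ∑ i, a i * z i) z

lemma gr_meas {k : ℕ} :
    Measurable (fun t : ℝ × (Fin k → ℝ) × (Fin k → ℝ) => gr t.1 t.2.1 t.2.2) := by
  rw [measurable_pi_iff]
  intro i
  refine Fin.cases ?_ (fun i => ?_) i
  · simp only [gr, Fin.cons_zero]; fun_prop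
  · simp only [gr, Fin.cons_succ]; fun_prop

lemma gr_meas' {k : ℕ} (b : ℝ) (a : Fin k → ℝ) : Measurable (gr b a) :=
  gr_meas.comp (g := fun t : ℝ × (Fin k → ℝ) × (Fin k → ℝ) => gr t.1 t.2.1 t.2.2)
    (f := fun z => (b, a, z)) (by fun_prop)

noncomputable def pp {k : ℕ} (b : ℝ) (a : Fin k → ℝ) : ProbabilityMeasure (Fin (k+1) → ℝ) :=
  ⟨(gam k).map (gr b a), Measure.isProbabilityMeasure_map (gr_meas' b a).aemeasurable⟩

lemma pp_mem {k : ℕ} (b : ℝ) (a : Fin k → ℝ) : pp b a ∈ GaussianClass (k+1) := by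
  let M : Matrix (Fin (k+1)) (Fin k) ℝ := Fin.cons a (1 : Matrix (Fin k) (Fin k) ℝ)
  refine ⟨Fin.cons b 0, M * Mᴴ, Matrix.posSemidef_self_mul_conjTranspose M, fun u => ?_⟩
  have hM : ∀ i, (Mᵀ *ᵥ u) i = u 0 * a i + u i.succ := by
    intro i
    have e0 : M 0 = a := rfl
    have e1 : ∀ j : Fin k, M j.succ = (1 : Matrix (Fin k) (Fin k) ℝ) j := fun j => rfl
    simp [Matrix.mulVec, dotProduct, Fin.sum_univ_succ, Matrix.transpose_apply, e0, e1,
      Matrix.one_apply, mul_comm]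
  have h1 : u ⬝ᵥ (M * Mᴴ) *ᵥ u = ∑ i, (u 0 * a i + u i.succ) ^ 2 := by
    rw [← Matrix.mulVec_mulVec, Matrix.dotProduct_mulVec, ← Matrix.mulVec_transpose]
    simp only [dotProduct, Matrix.conjTranspose_eq_transpose_of_trivial, hM, sq]
  rw [h1]
  change ((gam k).map (gr b a)).map _ = _
  rw [Measure.map_map (by fun_prop) (gr_meas' b a)]
  have h2 : ((fun x : Fin (k+1) → ℝ => ∑ i, u i * x i) ∘ gr b a) =
      (fun x => x + u 0 * b) ∘ (fun z => ∑ i, (u 0 * a i + u i.succ) * z i) := by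
    ext z
    simp only [Function.comp, Fin.sum_univ_succ, gr, Fin.cons_zero, Fin.cons_succ, add_mul,
      Finset.sum_add_distrib, mul_add, Finset.mul_sum, mul_assoc]
    ring
  rw [h2, ← Measure.map_map (by fun_prop) (by fun_prop), gam_lin, gaussianReal_map_add_const]
  simp [Fin.sum_univ_succ]

lemma gam_hyper {k : ℕ} (v : Fin k → ℝ) : ∀ᵐ z ∂(gam k), ∑ i, v i * z i ≠ 1 := by
  by_cases hv : ∑ i, v i ^ 2 = 0
  · have : ∀ i, v i = 0 := by
      rw [Finset.sum_eq_zero_iff_of_nonneg (fun i _ => sq_nonneg _)] at hv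
      intro i; simpa using hv i
    simp [this]
  · have hpos : 0 < ∑ i, v i ^ 2 :=
      lt_of_le_of_ne (Finset.sum_nonneg fun i _ => sq_nonneg _) (Ne.symm hv)
    have := nullSingletonClass_gaussianReal (μ := 0) (v := Real.toNNReal (∑ i, v i ^ 2))
      (by simpa using hpos)
    rw [← gam_lin] at this
    have h := measure_singleton (μ := (gam k).map (fun z => ∑ i, v i * z i)) (1:ℝ)
    rw [Measure.map_apply (by fun_prop) (by measurability)] at h
    rw [ae_iff]
    simp only [ne_eq, not_not]
    exact h

lemma group_priv {X Y : Type*} [MeasurableSpace X] [MeasurableSpace Y] {n : ℕ}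
    (A : (Fin n → X) → Measure Y) (h : IsDP A 1) (x x' : Fin n → X) (B : Set Y)
    (hB : MeasurableSet B) : A x B ≤ ENNReal.ofReal (Real.exp 1) ^ n * A x' B := by
  classical
  have key : ∀ s : Finset (Fin n),
      A (s.piecewise x x') B ≤ ENNReal.ofReal (Real.exp 1) ^ s.card * A x' B := by
    intro s
    induction s using Finset.induction_on with
    | empty => simp
    | insert i s hi ih =>
      rw [Finset.card_insert_of_notMem hi, pow_succ', mul_assoc]
      refine (h _ (s.piecewise x x') ⟨i, fun j hj => ?_⟩ B hB).trans (by gcongr)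
      simp [Finset.piecewise, hj]
  simpa using key Finset.univ

/-- the vector `v` with `X v = 1` -/
noncomputable def vv {k : ℕ} (x : Fin k → Fin k → ℝ) : Fin k → ℝ :=
  (Matrix.of x)⁻¹ *ᵥ 1

lemma vv_meas {k : ℕ} : Measurable (vv (k := k)) := by
  rw [measurable_pi_iff]
  intro i
  simp only [vv, Matrix.inv_def, Ring.inverse_eq_inv']
  have c1 : Continuous fun x : Fin k → Fin k → ℝ => (Matrix.of x).det :=
    Continuous.matrix_det (A := fun x : Fin k → Fin k → ℝ => Matrix.of x) continuous_id
  have h1 := c1.measurable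
  have c2 : ∀ j, Continuous fun x : Fin k → Fin k → ℝ => (Matrix.of x).adjugate i j := fun j =>
    (Continuous.matrix_adjugate (A := fun x : Fin k → Fin k → ℝ => Matrix.of x)
      continuous_id).matrix_elem i j
  have h2 : ∀ j, Measurable fun x : Fin k → Fin k → ℝ => (Matrix.of x).adjugate i j := fun j =>
    (c2 j).measurable
  simp only [Matrix.mulVec, dotProduct, Matrix.smul_apply, smul_eq_mul, Pi.one_apply, mul_one]
  exact Finset.measurable_sum _ fun j _ => h1.inv.mul (h2 j)

/-- hyperplane minus the flat through the public samples -/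
def EE {k : ℕ} (b : ℝ) (a : Fin k → ℝ) (x : Fin k → Fin k → ℝ) : Set (Fin (k+1) → ℝ) :=
  {z | z 0 = b + ∑ i, a i * z i.succ ∧ ∑ i, vv x i * z i.succ ≠ 1}

def BB {k : ℕ} (b : ℝ) (a : Fin k → ℝ) (x : Fin k → Fin k → ℝ) :
    Set (ProbabilityMeasure (Fin (k+1) → ℝ)) :=
  {q | 3/4 ≤ q.toMeasure (EE b a x)}

abbrev TT (k : ℕ) := (ℝ × (Fin k → ℝ)) × (Fin k → Fin k → ℝ)

lemma EE_meas (k : ℕ) : MeasurableSet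
    {s : TT k × (Fin (k+1) → ℝ) | s.2 ∈ EE s.1.1.1 s.1.1.2 s.1.2} := by
  have hv : ∀ i, Measurable fun s : TT k × (Fin (k+1) → ℝ) => vv s.1.2 i := fun i =>
    (measurable_pi_apply i).comp (vv_meas.comp (by fun_prop))
  apply MeasurableSet.inter
  · exact measurableSet_eq_fun (by fun_prop) (by fun_prop)
  · exact (measurableSet_eq_fun
      (Finset.measurable_sum _ fun i _ => (hv i).mul (by fun_prop)) measurable_const).compl

lemma EE_meas' {k : ℕ} (b : ℝ) (a : Fin k → ℝ) (x : Fin k → Fin k → ℝ) :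
    MeasurableSet (EE b a x) :=
  measurable_prodMk_left (x := (((b, a), x) : TT k)) (EE_meas k)

lemma BB_meas (k : ℕ) : MeasurableSet
    {s : TT k × ProbabilityMeasure (Fin (k+1) → ℝ) | s.2 ∈ BB s.1.1.1 s.1.1.2 s.1.2} := by
  let κ : Kernel (TT k × ProbabilityMeasure (Fin (k+1) → ℝ)) (Fin (k+1) → ℝ) :=
    ⟨fun s => s.2.toMeasure, measurable_subtype_coe.comp measurable_snd⟩
  have : IsMarkovKernel κ := ⟨fun s => s.2.2⟩
  have h := Kernel.measurable_kernel_prodMk_left (κ := κ)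
    (t := {w | (w.1.1, w.2) ∈ {s : TT k × (Fin (k+1) → ℝ) | s.2 ∈ EE s.1.1.1 s.1.1.2 s.1.2}})
    (by
      have hm : Measurable fun w : (TT k × ProbabilityMeasure (Fin (k+1) → ℝ)) × (Fin (k+1) → ℝ) =>
        (w.1.1, w.2) := by fun_prop
      exact hm (EE_meas k))
  exact measurableSet_le measurable_const h

lemma BB_meas' {k : ℕ} (b : ℝ) (a : Fin k → ℝ) (x : Fin k → Fin k → ℝ) :
    MeasurableSet (BB b a x) :=
  measurable_prodMk_left (x := (((b, a), x) : TT k)) (BB_meas k)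

lemma ball_sub {k : ℕ} (b : ℝ) (a : Fin k → ℝ) (x : Fin k → Fin k → ℝ) :
    {q : ProbabilityMeasure (Fin (k+1) → ℝ) | tv q.toMeasure (pp b a).toMeasure ≤ 1/4}
      ⊆ BB b a x := by
  intro q hq
  have h1 : (pp b a).toMeasure (EE b a x) = 1 := by
    change (gam k).map (gr b a) _ = 1
    rw [Measure.map_apply (gr_meas' b a) (EE_meas' b a x), prob_compl_eq_zero_iff
      (μ := gam k) ((gr_meas' b a) (EE_meas' b a x)) |>.1]
    change ∀ᵐ z ∂(gam k), _
    filter_upwards [gam_hyper (vv x)] with z hz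
    simpa [EE, gr] using hz
  have hb : |(q.toMeasure (EE b a x)).toReal - ((pp b a).toMeasure (EE b a x)).toReal| ≤ 1/4 := by
    refine le_trans ?_ hq
    refine le_ciSup (f := fun B : {s : Set (Fin (k+1) → ℝ) // MeasurableSet s} =>
      |(q.toMeasure B).toReal - ((pp b a).toMeasure B).toReal|) ⟨1, ?_⟩ ⟨_, EE_meas' b a x⟩
    rintro _ ⟨B, rfl⟩
    have e1 : (q.toMeasure B).toReal ≤ 1 := measureReal_le_one (μ := q.toMeasure)
    have e2 : ((pp b a).toMeasure B).toReal ≤ 1 := measureReal_le_one (μ := (pp b a).toMeasure)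
    have e3 : 0 ≤ (q.toMeasure B).toReal := ENNReal.toReal_nonneg
    have e4 : 0 ≤ ((pp b a).toMeasure B).toReal := ENNReal.toReal_nonneg
    exact abs_le.2 ⟨by linarith, by linarith⟩
  rw [h1, ENNReal.toReal_one, abs_le] at hb
  change (3/4 : ℝ≥0∞) ≤ _
  rw [← ENNReal.ofReal_toReal (measure_ne_top q.toMeasure (EE b a x))]
  have : (3/4 : ℝ≥0∞) = ENNReal.ofReal (3/4) := by
    rw [ENNReal.ofReal_div_of_pos (by norm_num)]; simp
  rw [this]
  exact ENNReal.ofReal_le_ofReal (by linarith)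

lemma BB_disj {k : ℕ} (a : Fin k → ℝ) (x : Fin k → Fin k → ℝ) :
    Pairwise (Function.onFun Disjoint (fun b : ℝ => BB b (a - b • vv x) x)) := by
  intro b b' hbb
  rw [Function.onFun, Set.disjoint_left]
  intro q h1 h2
  have hd : Disjoint (EE b (a - b • vv x) x) (EE b' (a - b' • vv x) x) := by
    rw [Set.disjoint_left]
    rintro z ⟨e1, e2⟩ ⟨e3, -⟩
    rw [e1] at e3
    simp only [Pi.sub_apply, Pi.smul_apply, smul_eq_mul, sub_mul, Finset.sum_sub_distrib,
      mul_assoc, ← Finset.mul_sum] at e3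
    apply hbb
    have : (b - b') * (1 - ∑ i, vv x i * z i.succ) = 0 := by linarith
    rcases mul_eq_zero.1 this with h | h
    · linarith
    · exact absurd (by linarith) e2
  have h3 := measure_union hd (EE_meas' b' (a - b' • vv x) x) (μ := q.toMeasure)
  have h4 : q.toMeasure (EE b (a - b • vv x) x ∪ EE b' (a - b' • vv x) x) ≤ 1 := prob_le_one
  rw [h3] at h4
  have h5 : (3/4 + 3/4 : ℝ≥0∞) ≤ 1 := (add_le_add h1 h2).trans h4
  have := ENNReal.toReal_mono (by simp) h5
  rw [ENNReal.toReal_add (by finiteness) (by finiteness)] at this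
  norm_num at this

lemma inv_open (k : ℕ) : IsOpen {x : Fin k → Fin k → ℝ | (Matrix.of x).det ≠ 0} :=
  isOpen_ne_fun
    (Continuous.matrix_det (A := fun x : Fin k → Fin k → ℝ => Matrix.of x) continuous_id)
    continuous_const

lemma inv_pos (k : ℕ) :
    iid (gam k) k {x : Fin k → Fin k → ℝ | (Matrix.of x).det ≠ 0} ≠ 0 := by
  have h0 : (gaussianReal 0 1).IsOpenPosMeasure :=
    (gaussianReal_absolutelyContinuous' 0 one_ne_zero).isOpenPosMeasure
  have h1 : (gam k).IsOpenPosMeasure := inferInstance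
  have h2 : (iid (gam k) k).IsOpenPosMeasure := by unfold iid; infer_instance
  refine (inv_open k).measure_ne_zero _ ⟨(1 : Matrix (Fin k) (Fin k) ℝ), ?_⟩
  change (1 : Matrix (Fin k) (Fin k) ℝ).det ≠ 0
  simp

lemma vv_spec {k : ℕ} (x : Fin k → Fin k → ℝ) (hx : (Matrix.of x).det ≠ 0) (j : Fin k) :
    ∑ i, vv x i * x j i = 1 := by
  have h : (Matrix.of x) *ᵥ vv x = 1 := by
    rw [vv, Matrix.mulVec_mulVec, Matrix.mul_nonsing_inv _ (isUnit_iff_ne_zero.2 hx),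
      Matrix.one_mulVec]
  have := congrFun h j
  simpa [Matrix.mulVec, dotProduct, mul_comm] using this

noncomputable def xt {k : ℕ} (t : TT k) : Fin k → Fin (k+1) → ℝ :=
  fun j => gr t.1.1 t.1.2 (t.2 j)

lemma xt_meas (k : ℕ) : Measurable (xt (k := k)) := by
  rw [measurable_pi_iff]
  intro j
  exact gr_meas.comp (g := fun t : ℝ × (Fin k → ℝ) × (Fin k → ℝ) => gr t.1 t.2.1 t.2.2)
    (f := fun t : TT k => (t.1.1, t.1.2, t.2 j)) (by fun_prop)

theorem main_k (k n : ℕ) (β : ℝ)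
    (hβ0 : 0 ≤ β) (hβ : ENNReal.ofReal β < iid (gam k) k {x : Fin k → Fin k → ℝ | (Matrix.of x).det ≠ 0})
    (A : (Fin k → (Fin (k+1) → ℝ)) → (Fin n → (Fin (k+1) → ℝ)) →
            Measure (ProbabilityMeasure (Fin (k+1) → ℝ)))
    (hA : IsPPLearner (GaussianClass (k+1)) (1/4) β 1 A) : False := by
  have hprob := hA.isProb
  have hiid : IsProbabilityMeasure (iid (gam k) k) := by unfold iid; infer_instance
  let κ : Kernel (TT k) (ProbabilityMeasure (Fin (k+1) → ℝ)) :=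
    ⟨fun t => A (xt t) 0, hA.measurable.comp ((xt_meas k).prodMk measurable_const)⟩
  have hκ : IsMarkovKernel κ := ⟨fun t => hprob _ _⟩
  have hG : Measurable fun t : TT k => A (xt t) 0 (BB t.1.1 t.1.2 t.2) :=
    Kernel.measurable_kernel_prodMk_left (κ := κ) (BB_meas k)
  have hP : MeasurableSet {t : TT k | A (xt t) 0 (BB t.1.1 t.1.2 t.2) = 0} :=
    hG (measurableSet_singleton 0)
  have step1 : ∀ x : Fin k → Fin k → ℝ, (Matrix.of x).det ≠ 0 →
      ∀ᵐ θ : ℝ × (Fin k → ℝ) ∂(volume.prod volume), A (xt (θ, x)) 0 (BB θ.1 θ.2 x) = 0 := by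
    intro x hx
    have hm1 : MeasurableSet {θ : ℝ × (Fin k → ℝ) | A (xt (θ, x)) 0 (BB θ.1 θ.2 x) = 0} :=
      measurable_prodMk_right (y := x) hP
    rw [Measure.ae_prod_iff_ae_ae hm1]
    have h1 : ∀ᵐ a : Fin k → ℝ, ∀ᵐ b : ℝ,
        A (xt ((b, a - b • vv x), x)) 0 (BB b (a - b • vv x) x) = 0 := by
      refine Filter.Eventually.of_forall fun a => ?_
      have hc : ∀ b : ℝ, xt ((b, a - b • vv x), x) = xt ((0, a), x) := by
        intro b
        ext j i
        refine Fin.cases ?_ (fun i => ?_) i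
        · simp only [xt, gr, Fin.cons_zero, Pi.sub_apply, Pi.smul_apply, smul_eq_mul, sub_mul,
            Finset.sum_sub_distrib, mul_assoc, ← Finset.mul_sum, vv_spec x hx j]
          ring
        · simp [xt, gr]
      simp only [hc]
      have hcount := Measure.countable_meas_pos_of_disjoint_iUnion
        (μ := A (xt ((0, a), x)) 0) (As := fun b : ℝ => BB b (a - b • vv x) x)
        (fun b => BB_meas' _ _ _) (BB_disj a x)
      filter_upwards [hcount.ae_notMem volume] with b hb
      simpa using hb
    have hm2 : MeasurableSet {s : (Fin k → ℝ) × ℝ |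
        A (xt ((s.2, s.1 - s.2 • vv x), x)) 0 (BB s.2 (s.1 - s.2 • vv x) x) = 0} := by
      have hf : Measurable fun s : (Fin k → ℝ) × ℝ => (s.2, s.1 - s.2 • vv x) := by fun_prop
      exact hf hm1
    rw [Measure.ae_ae_comm hm2] at h1
    filter_upwards [h1] with b hb
    have h2 := (measurePreserving_add_right volume (b • vv x)).quasiMeasurePreserving.ae hb
    simpa using h2
  have step2 : ∀ᵐ x ∂(iid (gam k) k), ∀ᵐ θ : ℝ × (Fin k → ℝ) ∂(volume.prod volume),
      ((Matrix.of x).det ≠ 0 → A (xt (θ, x)) 0 (BB θ.1 θ.2 x) = 0) := by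
    refine Filter.Eventually.of_forall fun x => ?_
    by_cases hx : (Matrix.of x).det ≠ 0
    · filter_upwards [step1 x hx] with θ h _ using h
    · exact Filter.Eventually.of_forall fun θ h => absurd h hx
  have hinv := (inv_open k).measurableSet
  have hm3 : MeasurableSet {s : (Fin k → Fin k → ℝ) × (ℝ × (Fin k → ℝ)) |
      ((Matrix.of s.1).det ≠ 0 → A (xt (s.2, s.1)) 0 (BB s.2.1 s.2.2 s.1) = 0)} := by
    have e1 : MeasurableSet {s : (Fin k → Fin k → ℝ) × (ℝ × (Fin k → ℝ)) |
      (Matrix.of s.1).det ≠ 0} := measurable_fst hinv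
    have e2 : MeasurableSet {s : (Fin k → Fin k → ℝ) × (ℝ × (Fin k → ℝ)) |
      A (xt (s.2, s.1)) 0 (BB s.2.1 s.2.2 s.1) = 0} := measurable_swap hP
    exact e1.imp e2
  rw [Measure.ae_ae_comm hm3] at step2
  obtain ⟨⟨b, a⟩, hθ⟩ := step2.exists
  have hacc := hA.accurate _ (pp_mem b a)
  have hmap : iid (pp b a).toMeasure k = (iid (gam k) k).map (fun x => xt ((b, a), x)) := by
    have := Measure.pi_map_pi (μ := fun _ : Fin k => gam k) (f := fun _ => gr b a)
      (fun _ => (gr_meas' b a).aemeasurable)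
    exact this.symm
  have hxm : Measurable (fun x : Fin k → Fin k → ℝ => xt ((b, a), x)) :=
    (xt_meas k).comp measurable_prodMk_left
  have hpn : IsProbabilityMeasure (iid (pp b a).toMeasure n) := by unfold iid; infer_instance
  rw [hmap] at hacc
  have hle := hacc.trans (lintegral_map_le _ _)
  have hbound : ∀ᵐ x ∂(iid (gam k) k),
      (∫⁻ y, A (xt ((b, a), x)) y {q : ProbabilityMeasure (Fin (k+1) → ℝ) |
        tv q.toMeasure (pp b a).toMeasure ≤ 1/4} ∂(iid (pp b a).toMeasure n)) ≤
      {x : Fin k → Fin k → ℝ | (Matrix.of x).det ≠ 0}ᶜ.indicator 1 x := by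
    filter_upwards [hθ] with x hx
    by_cases hd : (Matrix.of x).det ≠ 0
    · have hz : ∀ y, A (xt ((b, a), x)) y {q : ProbabilityMeasure (Fin (k+1) → ℝ) |
        tv q.toMeasure (pp b a).toMeasure ≤ 1/4} = 0 := by
        intro y
        have h1 := group_priv (A (xt ((b, a), x))) (hA.dp _) y 0 _ (BB_meas' b a x)
        rw [hx hd, mul_zero] at h1
        exact le_antisymm ((measure_mono (ball_sub b a x)).trans h1) zero_le
      simp only [hz, lintegral_zero, zero_le]
    · rw [Set.indicator_of_mem (by simpa using hd)]
      refine (lintegral_mono (g := fun _ => 1) fun y => prob_le_one).trans ?_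
      simp
  have h5 := hle.trans (lintegral_mono_ae hbound)
  rw [lintegral_indicator_one hinv.compl, prob_compl_eq_one_sub hinv] at h5
  set c := iid (gam k) k {x : Fin k → Fin k → ℝ | (Matrix.of x).det ≠ 0} with hc
  have hc1 : c ≤ 1 := prob_le_one
  have hct : c ≠ ⊤ := (hc1.trans_lt one_lt_top).ne
  have h6 := ENNReal.toReal_mono (by finiteness) h5
  rw [ENNReal.toReal_sub_of_le hc1 (by simp), ENNReal.toReal_one] at h6
  have h7 : 1 - β ≤ (ENNReal.ofReal (1 - β)).toReal := by
    rw [ENNReal.toReal_ofReal']; exact le_max_left _ _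
  have h8 := (ENNReal.ofReal_lt_iff_lt_toReal hβ0 hct).1 hβ
  linarith


end Aux

/-- **Lower bound for public-privately learning Gaussians** (Theorem 6.1): for `d ≥ 1`,
the class of all Gaussians on `ℝ^d` is not public-privately learnable with `d − 1` public
samples: there exist `α_d, β_d > 0` such that for every `n`, there is no
`(α_d, β_d, 1)`-public-private learner for the class using `d − 1` public and `n` private
samples. -/
theorem lowerBound_ppLearning_gaussians (d : ℕ) (hd : 1 ≤ d) :
    ∃ αd βd : ℝ, 0 < αd ∧ 0 < βd ∧
      ∀ n : ℕ,
        ¬ ∃ A : (Fin (d-1) → (Fin d → ℝ)) → (Fin n → (Fin d → ℝ)) →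
            Measure (ProbabilityMeasure (Fin d → ℝ)),
          IsPPLearner (GaussianClass d) αd βd 1 A := by
  obtain ⟨k, rfl⟩ : ∃ k, d = k + 1 := ⟨d - 1, by omega⟩
  have hpos := inv_pos k
  have hiid : IsProbabilityMeasure (iid (gam k) k) := by unfold iid; infer_instance
  obtain ⟨r, hr0, hr⟩ := ENNReal.lt_iff_exists_nnreal_btwn.1 (pos_iff_ne_zero.2 hpos)
  refine ⟨1/4, r, by norm_num, by exact_mod_cast hr0, fun n => ?_⟩
  rintro ⟨A, hA⟩
  exact main_k k n r r.2 (by simpa using hr) A hA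

end PubPriv
end
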